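/- Let M ≥ 1 and H ≥ 1 be integers, m > 0, and fix U⁰ ∈ ℝ^M. For each task index η ∈ {1, …, H}, let D^η ∈ ℝ^{M × M} be an invertible diagonal matrix. Let K ⊆ ℝ^M be compact and set K̃ := ⋃_{η=1}^H D^η(K). Let R : ℝ^M × ℝ^M → ℝ^M be continuous with ‖R(x, g̃) − R(y, g̃)‖ ≤ m·‖x − y‖ for all x, y, g̃ ∈ ℝ^M, and let U^* : K̃ → ℝ^M be such that, defining U^0(g̃) := U⁰ and U^{l+1}(g̃) := U^l(g̃) + R(U^l(g̃), g̃), for every δ > 0 there exists L₀ such that ‖U^l(g̃) − U^*(g̃)‖ ≤ δ for all l > L₀ and all g̃ ∈ K̃. Then for every ε > 0 there exist an integer L ≥ 1, a feature dimension d_h ≥ 1, task-wise lifting matrices P^η ∈ ℝ^{d_h·M × 2M} (η = 1, …, H), a shared iterative-layer weight matrix V ∈ ℝ^{d_h × d_h} and bias vector C ∈ ℝ^{d_h·M}, and a shared projection matrix Q ∈ ℝ^{M × d_h·M}, such that for every task η and every G ∈ K, ‖Q · 𝒥^L(P^η·[U⁰; G]) − U^*(D^η·G)‖ ≤ ε,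 where 𝒥(H) := H + (1/L)·ReLU((𝟙_{M×M} ⊗ V)·H + C). -/

import Mathlib

open scoped Kronecker

/-- The Euclidean norm on `ℝ^M` (vectors indexed by `Fin M`). -/
noncomputable def eNorm {M : ℕ} (v : Fin M → ℝ) : ℝ :=
  ‖(WithLp.equiv 2 (Fin M → ℝ)).symm v‖

/-- The rectified linear unit applied componentwise. -/
def relu {n : Type*} (z : n → ℝ) : n → ℝ := fun i => max (z i) 0

/-- The all-ones `M × M` matrix `𝟙_{M×M}`. -/
def onesMat (M : ℕ) : Matrix (Fin M) (Fin M) ℝ := Matrix.of fun _ _ => (1 : ℝ)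

section ReluApproximation

open Set

/-- The one-dimensional ReLU network interpolating `g` at the nodes `a + k * h`, `k ≤ n`. -/
noncomputable def reluInterpolant (g : ℝ → ℝ) (a h : ℝ) (n : ℕ) (t : ℝ) : ℝ :=
  g a + ∑ k ∈ Finset.range n, (g (a + (k + 1) * h) - g (a + k * h)) *
    (max (h⁻¹ * t + -(h⁻¹ * (a + k * h))) 0 - max (h⁻¹ * t + (-(h⁻¹ * (a + k * h)) - 1)) 0)

theorem reluInterpolant_succ (g : ℝ → ℝ) (a h : ℝ) (n : ℕ) (t : ℝ) :
    reluInterpolant g a h (n + 1) t = reluInterpolant g a h n t +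
      (g (a + (n + 1) * h) - g (a + n * h)) *
        (max (h⁻¹ * (t - (a + n * h))) 0 - max (h⁻¹ * (t - (a + n * h)) - 1) 0) := by
  rw [reluInterpolant, reluInterpolant, Finset.sum_range_succ, ← add_assoc]
  congr 4 <;> ring

theorem reluInterpolant_eq_of_le (g : ℝ → ℝ) (a : ℝ) {h : ℝ} (hh : 0 < h) (n : ℕ) {t : ℝ}
    (ht : a + n * h ≤ t) : reluInterpolant g a h n t = g (a + n * h) := by
  induction n with
  | zero => simp [reluInterpolant]
  | succ n ih =>
    push_cast at ht ⊢
    have h1 : 1 ≤ h⁻¹ * (t - (a + n * h)) := by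
      rw [inv_mul_eq_div, le_div_iff₀ hh]; linarith
    rw [reluInterpolant_succ, ih (by linarith), max_eq_left (by linarith),
      max_eq_left (by linarith)]
    ring

theorem abs_reluInterpolant_sub_le (g : ℝ → ℝ) (a : ℝ) {h ω : ℝ} (hh : 0 < h) (n : ℕ)
    (hg : ∀ x ∈ Icc a (a + n * h), ∀ y ∈ Icc a (a + n * h), |x - y| ≤ h → |g x - g y| ≤ ω)
    {t : ℝ} (ht : t ∈ Icc a (a + n * h)) : |reluInterpolant g a h n t - g t| ≤ 2 * ω := by
  induction n with
  | zero =>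
    obtain rfl : t = a := le_antisymm (by simpa using ht.2) ht.1
    have := hg t ht t ht (by simpa using hh.le)
    simp only [sub_self, abs_zero] at this
    simpa [reluInterpolant] using this
  | succ n ih =>
    have hn : (0 : ℝ) ≤ n * h := by positivity
    push_cast at hg ht
    rw [reluInterpolant_succ]
    rcases le_total t (a + n * h) with htn | htn
    · have h0 : h⁻¹ * (t - (a + n * h)) ≤ 0 :=
        mul_nonpos_of_nonneg_of_nonpos (by positivity) (by linarith)
      rw [max_eq_right h0, max_eq_right (by linarith), sub_zero, mul_zero, add_zero]
      exact ih (fun x hx y hy => hg x ⟨hx.1, by linarith [hx.2]⟩ y ⟨hy.1, by linarith [hy.2]⟩)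
        ⟨ht.1, htn⟩
    · have h0 : 0 ≤ h⁻¹ * (t - (a + n * h)) := mul_nonneg (by positivity) (by linarith)
      have h1 : h⁻¹ * (t - (a + n * h)) ≤ 1 := by
        rw [inv_mul_eq_div, div_le_one hh]; linarith [ht.2]
      rw [reluInterpolant_eq_of_le g a hh n htn, max_eq_left h0, max_eq_right (by linarith),
        sub_zero]
      have e1 := hg (a + (n + 1) * h) ⟨by linarith, le_rfl⟩ (a + n * h)
        ⟨by linarith, by linarith⟩ (by rw [abs_of_nonneg] <;> linarith)
      have e2 := hg (a + n * h) ⟨by linarith, by linarith⟩ t ht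
        (by rw [abs_sub_comm, abs_of_nonneg] <;> linarith [ht.2])
      calc _ = |(g (a + (n + 1) * h) - g (a + n * h)) * (h⁻¹ * (t - (a + n * h))) +
            (g (a + n * h) - g t)| := by congr 1; ring
        _ ≤ |g (a + (n + 1) * h) - g (a + n * h)| * (h⁻¹ * (t - (a + n * h))) +
            |g (a + n * h) - g t| := by
          refine (abs_add_le _ _).trans_eq ?_
          rw [abs_mul, abs_of_nonneg h0]
        _ ≤ ω * 1 + ω := by
          gcongr
          exact (abs_nonneg _).trans e1
        _ = 2 * ω := by ring

theorem exists_reluInterpolant_near {g : ℝ → ℝ} (hg : Continuous g) {B δ : ℝ} (hB : 0 < B)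
    (hδ : 0 < δ) :
    ∃ (h : ℝ) (n : ℕ), ∀ t ∈ Icc (-B) B, |reluInterpolant g (-B) h n t - g t| ≤ δ := by
  have huc := (isCompact_Icc (a := -B) (b := B)).uniformContinuousOn_of_continuous
    hg.continuousOn
  obtain ⟨r, hr, hr'⟩ := Metric.uniformContinuousOn_iff.1 huc (δ / 2) (by positivity)
  obtain ⟨n, hn⟩ := exists_nat_gt (2 * B / r)
  have hn0 : (0 : ℝ) < n := lt_of_le_of_lt (by positivity) hn
  have hend : -B + n * (2 * B / n) = B := by field_simp; ring
  refine ⟨2 * B / n, n, fun t ht => ?_⟩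
  have := abs_reluInterpolant_sub_le g (-B) (h := 2 * B / n) (ω := δ / 2) (by positivity) n
    (fun x hx y hy hxy => ?_) (t := t) (by rwa [hend])
  · linarith
  · rw [hend] at hx hy
    refine (hr' x hx y hy (lt_of_le_of_lt hxy ?_)).le
    rw [div_lt_iff₀ hr] at hn
    rw [div_lt_iff₀ hn0]
    linarith

variable {ι : Type*} [Fintype ι]

/-- The ReLU ridge function `x ↦ max (w · x + b) 0` on `s`, for `p = (w, b)`. -/
noncomputable def reluRidge (s : Set (ι → ℝ)) (p : (ι → ℝ) × ℝ) : C(s, ℝ) where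
  toFun x := max (p.1 ⬝ᵥ (x : ι → ℝ) + p.2) 0
  continuous_toFun :=
    ((continuous_const.dotProduct continuous_subtype_val).add continuous_const).max continuous_const

/-- The functions `x ↦ exp (w · x)` on `s`, as a monoid homomorphism in `w`. -/
noncomputable def expRidge (s : Set (ι → ℝ)) : Multiplicative (ι → ℝ) →* C(s, ℝ) where
  toFun w :=
    { toFun := fun x => Real.exp (w.toAdd ⬝ᵥ (x : ι → ℝ))
      continuous_toFun :=
        Real.continuous_exp.comp (continuous_const.dotProduct continuous_subtype_val) }
  map_one' := by ext x; simp
  map_mul' v w := by ext x; simp [Real.exp_add, add_dotProduct]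

theorem adjoin_expRidge_topologicalClosure (s : Set (ι → ℝ)) [CompactSpace s] :
    (Algebra.adjoin ℝ (range (expRidge s))).topologicalClosure = ⊤ := by
  classical
  apply ContinuousMap.subalgebra_topologicalClosure_eq_top_of_separatesPoints
  intro x y hxy
  obtain ⟨i, hi⟩ := Function.ne_iff.1 (Subtype.coe_ne_coe.2 hxy)
  refine ⟨_, ⟨expRidge s (.ofAdd (Pi.single i 1)), Algebra.subset_adjoin ⟨_, rfl⟩, rfl⟩, ?_⟩
  simpa [expRidge] using hi

theorem expRidge_mem_closure_span_reluRidge (s : Set (ι → ℝ)) [CompactSpace s]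
    (w : Multiplicative (ι → ℝ)) :
    expRidge s w ∈ (Submodule.span ℝ (range (reluRidge s))).topologicalClosure := by
  have hmem : ∀ p, reluRidge s p ∈ Submodule.span ℝ (range (reluRidge s)) := fun p =>
    Submodule.subset_span ⟨p, rfl⟩
  rw [← SetLike.mem_coe, Submodule.topologicalClosure_coe, Metric.mem_closure_iff]
  intro δ hδ
  let ℓ : C(s, ℝ) := ⟨fun x => w.toAdd ⬝ᵥ (x : ι → ℝ),
    continuous_const.dotProduct continuous_subtype_val⟩
  have hB : 0 < ‖ℓ‖ + 1 := by positivity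
  obtain ⟨h, n, hn⟩ := exists_reluInterpolant_near Real.continuous_exp hB (half_pos hδ)
  set a := -(‖ℓ‖ + 1) with ha
  let f : C(s, ℝ) := Real.exp a • reluRidge s (0, 1) +
    ∑ k ∈ Finset.range n, (Real.exp (a + (k + 1) * h) - Real.exp (a + k * h)) •
      (reluRidge s (h⁻¹ • w.toAdd, -(h⁻¹ * (a + k * h))) -
        reluRidge s (h⁻¹ • w.toAdd, -(h⁻¹ * (a + k * h)) - 1))
  refine ⟨f, ?_, ?_⟩
  · exact add_mem (Submodule.smul_mem _ _ (hmem _)) <| sum_mem fun k _ =>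
      Submodule.smul_mem _ _ (sub_mem (hmem _) (hmem _))
  · refine lt_of_le_of_lt ((ContinuousMap.dist_le (half_pos hδ).le).2 fun x => ?_)
      (half_lt_self hδ)
    have hx := abs_le.1 (ℓ.norm_coe_le_norm x)
    have hf : f x = reluInterpolant Real.exp a h n (ℓ x) := by
      simp [f, reluInterpolant, reluRidge, ℓ, ContinuousMap.sum_apply]
    rw [dist_comm, Real.dist_eq, hf]
    exact hn (ℓ x) ⟨by linarith, by linarith⟩

theorem span_reluRidge_topologicalClosure (s : Set (ι → ℝ)) [CompactSpace s] :
    (Submodule.span ℝ (range (reluRidge s))).topologicalClosure = ⊤ := by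
  have hle : (Algebra.adjoin ℝ (range (expRidge s))).toSubmodule ≤
      (Submodule.span ℝ (range (reluRidge s))).topologicalClosure := by
    rw [Algebra.adjoin_eq_span, ← MonoidHom.coe_mrange, Submonoid.closure_eq,
      MonoidHom.coe_mrange, Submodule.span_le]
    rintro _ ⟨w, rfl⟩
    exact expRidge_mem_closure_span_reluRidge s w
  refine eq_top_iff.2 fun f _ => ?_
  have hf : f ∈ (Algebra.adjoin ℝ (range (expRidge s))).topologicalClosure := by
    simp [adjoin_expRidge_topologicalClosure]
  exact closure_minimal hle (Submodule.isClosed_topologicalClosure _) hf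

/-- Universal approximation by shallow ReLU networks: finitely many continuous functions on a
compact set are uniformly approximated by networks sharing the same hidden neurons. -/
theorem exists_shallow_relu_near {κ : Type*} [Fintype κ] {s : Set (ι → ℝ)} (hs : IsCompact s)
    {f : (ι → ℝ) → κ → ℝ} (hf : ContinuousOn f s) {δ : ℝ} (hδ : 0 < δ) :
    ∃ (T : Finset ((ι → ℝ) × ℝ)) (c : κ → (ι → ℝ) × ℝ → ℝ), ∀ x ∈ s, ∀ i,
      |∑ p ∈ T, c i p * max (p.1 ⬝ᵥ x + p.2) 0 - f x i| < δ := by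
  classical
  have : CompactSpace s := isCompact_iff_compactSpace.1 hs
  have key : ∀ i, ∃ c : ((ι → ℝ) × ℝ) →₀ ℝ, ∀ x ∈ s,
      |(c.sum fun p r => r * max (p.1 ⬝ᵥ x + p.2) 0) - f x i| < δ := by
    intro i
    let F : C(s, ℝ) := ⟨fun x => f x i,
      (continuous_apply i).comp (continuousOn_iff_continuous_domRestrict.1 hf)⟩
    have hF : F ∈ closure (Submodule.span ℝ (range (reluRidge s)) : Set C(s, ℝ)) := by
      rw [← Submodule.topologicalClosure_coe, span_reluRidge_topologicalClosure]
      trivial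
    obtain ⟨g, hg, hFg⟩ := Metric.mem_closure_iff.1 hF δ hδ
    obtain ⟨c, rfl⟩ := Finsupp.mem_span_range_iff_exists_finsupp.1 hg
    refine ⟨c, fun x hx => ?_⟩
    have := (ContinuousMap.dist_apply_le_dist ⟨x, hx⟩).trans_lt hFg
    rw [dist_comm, Real.dist_eq] at this
    simpa [Finsupp.sum, ContinuousMap.sum_apply, reluRidge, F] using this
  choose c hc using key
  refine ⟨Finset.univ.biUnion fun i => (c i).support, fun i => c i, fun x hx i => ?_⟩
  rw [← Finsupp.sum_of_support_subset (c i)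
    (Finset.subset_biUnion_of_mem (fun i => (c i).support) (Finset.mem_univ i))
    (fun p r => r * max (p.1 ⬝ᵥ x + p.2) 0) (by simp)]
  exact hc i x hx

end ReluApproximation

section EuclideanNorm

variable {M : ℕ}

theorem abs_apply_le_eNorm (v : Fin M → ℝ) (i : Fin M) : |v i| ≤ eNorm v :=
  PiLp.norm_apply_le ((WithLp.equiv 2 (Fin M → ℝ)).symm v) i

theorem eNorm_le_of_abs_le {v : Fin M → ℝ} {ε : ℝ} (hM : 1 ≤ M) (hε : 0 ≤ ε)
    (h : ∀ i, |v i| ≤ ε / M) : eNorm v ≤ ε := by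
  have hM' : (1 : ℝ) ≤ M := by exact_mod_cast hM
  rw [eNorm, EuclideanSpace.norm_eq]
  refine Real.sqrt_le_iff.2 ⟨hε, ?_⟩
  calc ∑ i, ‖((WithLp.equiv 2 (Fin M → ℝ)).symm v) i‖ ^ 2
      ≤ ∑ _i : Fin M, (ε / M) ^ 2 :=
        Finset.sum_le_sum fun i _ => pow_le_pow_left₀ (norm_nonneg _) (h i) 2
    _ = ε ^ 2 / M := by simp; field_simp
    _ ≤ ε ^ 2 := div_le_self (sq_nonneg ε) hM'

end EuclideanNorm

/-- A uniform limit, in the Euclidean norm, of the iterates of `x ↦ x + R x g` is continuous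
in the loading `g`. -/
theorem continuousOn_of_iterate_eNorm_le {M : ℕ} {U0 : Fin M → ℝ}
    {R : (Fin M → ℝ) → (Fin M → ℝ) → (Fin M → ℝ)}
    (hRcont : Continuous (fun p : (Fin M → ℝ) × (Fin M → ℝ) => R p.1 p.2))
    {Ustar : (Fin M → ℝ) → (Fin M → ℝ)} {s : Set (Fin M → ℝ)}
    (hConv : ∀ δ : ℝ, 0 < δ → ∃ L0 : ℕ, ∀ l : ℕ, l > L0 → ∀ gt ∈ s,
      eNorm ((fun x => x + R x gt)^[l] U0 - Ustar gt) ≤ δ) :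
    ContinuousOn Ustar s := by
  have hcont : ∀ l : ℕ, Continuous fun gt => (fun x => x + R x gt)^[l] U0 := by
    intro l
    induction l with
    | zero => exact continuous_const
    | succ l ih =>
      simp only [Function.iterate_succ_apply']
      exact ih.add (hRcont.comp (ih.prodMk continuous_id))
  have hunif : TendstoUniformlyOn (fun (l : ℕ) gt => (fun x => x + R x gt)^[l] U0) Ustar
      Filter.atTop s := by
    rw [Metric.tendstoUniformlyOn_iff]
    intro δ hδ
    obtain ⟨L0, hL0⟩ := hConv (δ / 2) (half_pos hδ)
    filter_upwards [Filter.eventually_gt_atTop L0] with l hl gt hgt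
    refine lt_of_le_of_lt ((dist_pi_le_iff (half_pos hδ).le).2 fun i => ?_) (half_lt_self hδ)
    rw [dist_comm]
    exact (abs_apply_le_eNorm _ i).trans (hL0 l hl gt hgt)
  exact hunif.continuousOn (Filter.Eventually.of_forall fun l => (hcont l).continuousOn).frequently

/-- A single MetaNO layer realizes a shallow ReLU network, precomposed with an arbitrary
task-wise linear map `A`. -/
theorem exists_metaNO_layer_eq_shallow_relu {M H : ℕ} (hM : 1 ≤ M)
    (A : Fin H → Matrix (Fin M) (Fin M) ℝ) (U0 : Fin M → ℝ)
    (T : Finset ((Fin M → ℝ) × ℝ)) (c : Fin M → (Fin M → ℝ) × ℝ → ℝ) :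
    ∃ (dh : ℕ), 1 ≤ dh ∧
      ∃ (P : Fin H → Matrix (Fin M × Fin dh) (Fin M ⊕ Fin M) ℝ)
        (V : Matrix (Fin dh) (Fin dh) ℝ) (C : Fin M × Fin dh → ℝ)
        (Q : Matrix (Fin M) (Fin M × Fin dh) ℝ), ∀ η G i,
          Q.mulVec ((P η).mulVec (Sum.elim U0 G) +
            relu ((onesMat M ⊗ₖ V).mulVec ((P η).mulVec (Sum.elim U0 G)) + C)) i =
          ∑ p ∈ T, c i p * max (p.1 ⬝ᵥ (A η).mulVec G + p.2) 0 := by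
  have hM0 : (M : ℝ) ≠ 0 := by exact_mod_cast (by omega : M ≠ 0)
  obtain ⟨dh, ⟨e⟩⟩ := Finite.exists_equiv_fin (Fin M ⊕ T)
  refine ⟨dh, ?_,
    fun η => Matrix.of fun ja l => Sum.elim (fun _ => 0) (fun l => Sum.elim
      (fun k => (M : ℝ)⁻¹ * A η k l) (fun _ => 0) (e.symm ja.2)) l,
    Matrix.of fun a b => Sum.elim (fun _ => 0) (fun p : T => Sum.elim
      (fun k => p.1.1 k) (fun _ => 0) (e.symm b)) (e.symm a),
    fun ja => Sum.elim (fun _ => 0) (fun p : T => p.1.2) (e.symm ja.2),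
    Matrix.of fun i ja => Sum.elim (fun _ => 0) (fun p : T => (M : ℝ)⁻¹ * c i p.1) (e.symm ja.2),
    fun η G i => ?_⟩
  · exact Nat.one_le_iff_ne_zero.2 fun h => (h ▸ e (.inl ⟨0, hM⟩)).elim0
  set P : Matrix (Fin M × Fin dh) (Fin M ⊕ Fin M) ℝ :=
    Matrix.of fun ja l => Sum.elim (fun _ => 0) (fun l => Sum.elim
      (fun k => (M : ℝ)⁻¹ * A η k l) (fun _ => 0) (e.symm ja.2)) l with hP
  have hlift : ∀ j a, P.mulVec (Sum.elim U0 G) (j, a) =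
      Sum.elim (fun k => (M : ℝ)⁻¹ * (A η).mulVec G k) (fun _ => 0) (e.symm a) := by
    intro j a
    cases h : e.symm a <;>
      simp [hP, Matrix.mulVec, dotProduct, h, Finset.mul_sum, mul_assoc]
  generalize P.mulVec (Sum.elim U0 G) = h0 at hlift
  simp only [Matrix.mulVec, dotProduct, Fintype.sum_prod_type, Matrix.of_apply, Pi.add_apply,
    relu, Matrix.kroneckerMap_apply, onesMat, one_mul, hlift]
  have hsum : ∀ f : Fin dh → ℝ,
      ∑ a, f a = ∑ k, f (e (.inl k)) + ∑ p, f (e (.inr p)) := fun f => by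
    rw [← e.sum_comp, Fintype.sum_sum_type]
  simp only [hsum, Equiv.symm_apply_apply, Sum.elim_inl,
    Sum.elim_inr, zero_mul, mul_zero, Finset.sum_const_zero, zero_add, add_zero,
    Finset.sum_const, Finset.card_univ, Fintype.card_fin, nsmul_eq_mul]
  rw [Finset.mul_sum, ← Finset.sum_coe_sort T]
  refine Finset.sum_congr rfl fun p _ => ?_
  rw [Finset.mul_sum, ← mul_assoc, ← mul_assoc, mul_inv_cancel₀ hM0, one_mul]
  congr 3
  refine Finset.sum_congr rfl fun k _ => ?_
  field_simp

/-- The paper's Theorem 1 (universal approximation for MetaNO, made precise): given `H`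
tasks with invertible diagonal reparameterization matrices `D^η`, a compact set `K` of
loadings with `K̃ = ⋃_η D^η(K)`, and a continuous `m`-Lipschitz fixed-point update `R`
whose iteration from the fixed initial guess `U⁰` converges uniformly on `K̃` to the exact
solutions `U^*`, for every `ε > 0` there exist a depth `L`, a feature dimension `d_h`,
task-wise lifting matrices `P^η`, shared iterative-layer parameters `(V, C)`, and a shared
projection matrix `Q`, such that the MetaNO output
`Q · 𝒥^L(P^η·[U⁰; G])`, with `𝒥(H) = H + (1/L)·ReLU((𝟙_{M×M} ⊗ V)·H + C)`, is within `ε`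
of `U^*(D^η·G)` for every task `η` and every loading `G ∈ K`. Hidden vectors in
`ℝ^{d_h·M}` are indexed by `Fin M × Fin d_h`; `[x; y] = Sum.elim x y ∈ ℝ^{2M}`. -/
theorem metaNO_universal_approximation
    (M H : ℕ) (hM : 1 ≤ M) (hH : 1 ≤ H) (m : ℝ) (hm : 0 < m)
    (U0 : Fin M → ℝ)
    (D : Fin H → Matrix (Fin M) (Fin M) ℝ)
    (hDdiag : ∀ η : Fin H, (D η).IsDiag)
    (hDinv : ∀ η : Fin H, IsUnit (D η))
    (K : Set (Fin M → ℝ)) (hK : IsCompact K)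
    (R : (Fin M → ℝ) → (Fin M → ℝ) → (Fin M → ℝ))
    (hRcont : Continuous (fun p : (Fin M → ℝ) × (Fin M → ℝ) => R p.1 p.2))
    (hRlip : ∀ x y gt : Fin M → ℝ, eNorm (R x gt - R y gt) ≤ m * eNorm (x - y))
    (Ustar : (Fin M → ℝ) → (Fin M → ℝ))
    (hConv : ∀ δ : ℝ, 0 < δ → ∃ L0 : ℕ, ∀ l : ℕ, l > L0 →
      ∀ gt ∈ ⋃ η : Fin H, (fun G => (D η).mulVec G) '' K,
        eNorm ((fun x => x + R x gt)^[l] U0 - Ustar gt) ≤ δ)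
    (ε : ℝ) (hε : 0 < ε) :
    ∃ (L : ℕ), 1 ≤ L ∧
      ∃ (dh : ℕ), 1 ≤ dh ∧
        ∃ (P : Fin H → Matrix (Fin M × Fin dh) (Fin M ⊕ Fin M) ℝ)
          (V : Matrix (Fin dh) (Fin dh) ℝ)
          (C : Fin M × Fin dh → ℝ)
          (Q : Matrix (Fin M) (Fin M × Fin dh) ℝ),
          ∀ η : Fin H, ∀ G ∈ K,
            eNorm
              (Q.mulVec
                ((fun Hv : Fin M × Fin dh → ℝ =>
                    Hv + (L : ℝ)⁻¹ • relu ((onesMat M ⊗ₖ V).mulVec Hv + C))^[L]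
                  ((P η).mulVec (Sum.elim U0 G)))
                - Ustar ((D η).mulVec G)) ≤ ε := by
  have hs : IsCompact (⋃ η : Fin H, (fun G => (D η).mulVec G) '' K) :=
    isCompact_iUnion fun η => hK.image (by fun_prop)
  have hM' : (0 : ℝ) < M := by exact_mod_cast hM
  obtain ⟨T, c, hT⟩ := exists_shallow_relu_near hs
    (continuousOn_of_iterate_eNorm_le hRcont hConv) (div_pos hε hM')
  obtain ⟨dh, hdh, P, V, C, Q, hnet⟩ := exists_metaNO_layer_eq_shallow_relu hM D U0 T c
  refine ⟨1, le_rfl, dh, hdh, P, V, C, Q, fun η G hG => eNorm_le_of_abs_le hM hε.le fun i => ?_⟩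
  rw [Function.iterate_one, Nat.cast_one, inv_one, one_smul, Pi.sub_apply, hnet]
  exact (hT _ (Set.mem_iUnion.2 ⟨η, G, hG, rfl⟩) i).le
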